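/- arXiv:2305.10633 — 2 statements merged into one kernel-verified Lean document; each statement's English description precedes it below -/
import Mathlib

section
/- (Smoothing preserves single-index structure) Let g: [−1,1] → ℝ and u, w ∈ S^{d−1}. Define the smoothing operator (𝓛_λ g)(w) = E_{z∼μ_w}[g((w+λz)/‖w+λz‖ · u)], where μ_w is uniform on {z ∈ S^{d−1} : z ⊥ w}. Then (𝓛_λ g)(w) = g_λ(w·u), where g_λ(α) = E_{z∼Unif(S^{d−2})}[g((α + λ z_1 √(1−α²))/√(1+λ²))]. -/
open MeasureTheory
open scoped RealInnerProductSpace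

noncomputable def sphereMarginal (d : ℕ) : Measure ℝ :=
  (volume.restrict (Set.Ioo (-1 : ℝ) 1)).withDensity fun x =>
    ENNReal.ofReal ((1 - x ^ 2) ^ (((d : ℝ) - 3) / 2) *
      (Real.Gamma ((d : ℝ) / 2) / (Real.sqrt Real.pi * Real.Gamma (((d : ℝ) - 1) / 2))))

lemma aux_radial {m : ℕ} (hm : 1 ≤ m) (h : ℝ → ENNReal) (hh : Measurable h) :
    ∫⁻ y : EuclideanSpace ℝ (Fin m), h ‖y‖ =
      (m * volume (Metric.ball (0 : EuclideanSpace ℝ (Fin m)) 1)) *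
        ∫⁻ r in Set.Ioi (0 : ℝ), ENNReal.ofReal (r ^ (m - 1)) * h r := by
  have : Nonempty (Fin m) := ⟨⟨0, hm⟩⟩
  set μ : Measure (EuclideanSpace ℝ (Fin m)) := volume with hμ
  have e1 : ∫⁻ y, h ‖y‖ ∂μ
      = ∫⁻ x : ({(0)}ᶜ : Set (EuclideanSpace ℝ (Fin m))), h ‖x.1‖ ∂(μ.comap (↑)) := by
    rw [lintegral_subtype_comap (measurableSet_singleton _).compl (fun x => h ‖x‖),
      restrict_compl_singleton]
  have e2 := μ.measurePreserving_homeomorphUnitSphereProd.lintegral_comp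
    (f := fun p => h p.2.1) (by fun_prop)
  simp only [homeomorphUnitSphereProd_apply_snd_coe] at e2
  rw [e1, e2, lintegral_prod _ (by fun_prop)]
  simp only [lintegral_const, Measure.toSphere_apply_univ, finrank_euclideanSpace, Fintype.card_fin]
  rw [mul_comm, Measure.volumeIoiPow, lintegral_withDensity_eq_lintegral_mul _ (by fun_prop) (by fun_prop)]
  congr 1
  exact lintegral_subtype_comap measurableSet_Ioi
    (fun r : ℝ => ENNReal.ofReal (r ^ (m - 1)) * h r)

lemma aux_isom {E F : Type*} [NormedAddCommGroup E] [InnerProductSpace ℝ E] [FiniteDimensional ℝ E]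
    [NormedAddCommGroup F] [InnerProductSpace ℝ F] [FiniteDimensional ℝ F]
    (h : Module.finrank ℝ E = Module.finrank ℝ F) (a : E) (b : F) (hab : ‖a‖ = ‖b‖) :
    ∃ L : E ≃ₗᵢ[ℝ] F, L a = b := by
  let L : E ≃ₗᵢ[ℝ] F := (stdOrthonormalBasis ℝ E).equiv (stdOrthonormalBasis ℝ F) (finCongr h)
  refine ⟨L.trans (Submodule.reflection (Submodule.span ℝ {L a - b})ᗮ), ?_⟩
  simpa using Submodule.reflection_sub (v := L a) (w := b) (by simpa using hab)

lemma aux_cos (m : ℕ) (hm : 1 ≤ m) (f : ℝ → ENNReal) :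
    ∫⁻ t in Set.Ioo (-1 : ℝ) 1, ENNReal.ofReal ((1 - t ^ 2) ^ (((m : ℝ) - 2) / 2)) * f t =
    ∫⁻ θ in Set.Ioo 0 Real.pi, ENNReal.ofReal (Real.sin θ ^ (m - 1)) * f (Real.cos θ) := by
  have him : Real.cos '' Set.Ioo 0 Real.pi = Set.Ioo (-1) 1 := by
    ext t
    constructor
    · rintro ⟨θ, hθ, rfl⟩
      have := Real.sin_pos_of_mem_Ioo hθ
      have h2 := Real.sin_sq_add_cos_sq θ
      constructor <;> nlinarith
    · rintro ht
      exact ⟨Real.arccos t, ⟨Real.arccos_pos.2 ht.2, Real.arccos_lt_pi.2 ht.1⟩,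
        Real.cos_arccos ht.1.le ht.2.le⟩
  rw [← him, lintegral_image_eq_lintegral_abs_deriv_mul measurableSet_Ioo
    (fun x _ => (Real.hasDerivAt_cos x).hasDerivWithinAt)
    (Real.injOn_cos.mono Set.Ioo_subset_Icc_self)]
  refine setLIntegral_congr_fun measurableSet_Ioo fun θ hθ => ?_
  have hs := Real.sin_pos_of_mem_Ioo hθ
  rw [← mul_assoc, ← ENNReal.ofReal_mul (abs_nonneg _), ← Real.sin_sq, abs_neg, abs_of_pos hs]
  congr 2
  rw [← Real.rpow_natCast (Real.sin θ) 2, ← Real.rpow_mul hs.le, ← Real.rpow_natCast]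
  nth_rewrite 1 [← Real.rpow_one (Real.sin θ)]
  rw [← Real.rpow_add hs]
  congr 1
  push_cast [hm]
  ring

lemma aux_polar (m : ℕ) (hm : 1 ≤ m) (f : ℝ → ENNReal) (hf : Measurable f) :
    ∫⁻ s : ℝ, ∫⁻ r in Set.Ioi (0 : ℝ), ENNReal.ofReal (r ^ (m - 1)) *
      (if s ^ 2 + r ^ 2 < 1 then f (s / √(s ^ 2 + r ^ 2)) else 0) =
    ENNReal.ofReal (1 / (m + 1)) *
      ∫⁻ θ in Set.Ioo 0 Real.pi, ENNReal.ofReal (Real.sin θ ^ (m - 1)) * f (Real.cos θ) := by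
  let G : ℝ × ℝ → ENNReal := fun p => if 0 < p.2 then ENNReal.ofReal (p.2 ^ (m - 1)) *
      (if p.1 ^ 2 + p.2 ^ 2 < 1 then f (p.1 / √(p.1 ^ 2 + p.2 ^ 2)) else 0) else 0
  have hG : Measurable G := by
    refine Measurable.ite (measurableSet_lt measurable_const measurable_snd) ?_ measurable_const
    refine Measurable.mul (by fun_prop) ?_
    refine Measurable.ite (measurableSet_lt (by fun_prop) measurable_const) ?_ measurable_const
    exact hf.comp (by fun_prop)
  have e1 : ∫⁻ s : ℝ, ∫⁻ r in Set.Ioi (0 : ℝ), ENNReal.ofReal (r ^ (m - 1)) *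
      (if s ^ 2 + r ^ 2 < 1 then f (s / √(s ^ 2 + r ^ 2)) else 0) = ∫⁻ p, G p := by
    rw [Measure.volume_eq_prod, lintegral_prod _ hG.aemeasurable]
    refine lintegral_congr fun s => ?_
    rw [← lintegral_indicator measurableSet_Ioi]
    refine lintegral_congr fun r => ?_
    simp only [Set.indicator, Set.mem_Ioi, G]
  rw [e1, ← lintegral_comp_polarCoord_symm]
  let A : ℝ → ENNReal := fun ρ => if ρ < 1 then ENNReal.ofReal (ρ ^ m) else 0
  let B : ℝ → ENNReal := fun θ => if 0 < θ then
    ENNReal.ofReal (Real.sin θ ^ (m - 1)) * f (Real.cos θ) else 0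
  have hA : Measurable A := Measurable.ite measurableSet_Iio (by fun_prop) measurable_const
  have hB : Measurable B := Measurable.ite measurableSet_Ioi (by fun_prop) measurable_const
  have e2 : ∫⁻ p in polarCoord.target, ENNReal.ofReal p.1 • G (polarCoord.symm p) =
      ∫⁻ p in Set.Ioi (0:ℝ) ×ˢ Set.Ioo (-Real.pi) Real.pi, A p.1 * B p.2 := by
    refine setLIntegral_congr_fun polarCoord.open_target.measurableSet ?_
    rintro ⟨ρ, θ⟩ ⟨hρ, hθ⟩
    simp only [Set.mem_Ioi, Set.mem_Ioo] at hρ hθ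
    simp only [polarCoord_symm_apply, G, A, B, smul_eq_mul]
    have hn : (ρ * Real.cos θ) ^ 2 + (ρ * Real.sin θ) ^ 2 = ρ ^ 2 := by
      have := Real.sin_sq_add_cos_sq θ
      linear_combination ρ ^ 2 * this
    rw [hn, Real.sqrt_sq hρ.le, mul_div_cancel_left₀ _ hρ.ne']
    have h1 : ρ ^ 2 < 1 ↔ ρ < 1 := by
      rw [sq_lt_one_iff₀ hρ.le]
    simp only [h1, mul_pos_iff_of_pos_left hρ]
    by_cases h0 : 0 < θ
    · have hs : 0 < Real.sin θ := Real.sin_pos_of_mem_Ioo ⟨h0, hθ.2⟩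
      simp only [h0, hs, if_true]
      split_ifs
      · rw [← mul_assoc, ← mul_assoc, ← ENNReal.ofReal_mul hρ.le, ← ENNReal.ofReal_mul (by positivity)]
        congr 2
        obtain ⟨k, rfl⟩ := Nat.exists_eq_add_of_le' hm
        simp; ring
      · simp
    · have hs : ¬ 0 < Real.sin θ := by
        rw [not_lt] at h0 ⊢
        exact Real.sin_nonpos_of_nonpos_of_neg_pi_le h0 hθ.1.le
      simp [h0, hs]
  rw [e2, Measure.volume_eq_prod, ← Measure.prod_restrict, lintegral_prod_mul hA.aemeasurable hB.aemeasurable]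
  congr 1
  · have : ∫⁻ ρ in Set.Ioi (0:ℝ), A ρ = ∫⁻ ρ in Set.Ioc (0:ℝ) 1, ENNReal.ofReal (ρ ^ m) := by
      rw [← restrict_Ioo_eq_restrict_Ioc, ← lintegral_indicator measurableSet_Ioi,
        ← lintegral_indicator measurableSet_Ioo]
      refine lintegral_congr fun r => ?_
      simp only [Set.indicator, Set.mem_Ioi, Set.mem_Ioo, A]
      split_ifs <;> simp_all
    rw [this, ← ofReal_integral_eq_lintegral_ofReal (intervalIntegral.intervalIntegrable_pow _).1,
      ← intervalIntegral.integral_of_le zero_le_one]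
    · simp
    · filter_upwards [ae_restrict_mem measurableSet_Ioc] with y hy
      exact pow_nonneg hy.1.le _
  · rw [← lintegral_indicator measurableSet_Ioo, ← lintegral_indicator measurableSet_Ioo]
    refine lintegral_congr fun r => ?_
    simp only [Set.indicator, Set.mem_Ioo, B]
    have := Real.pi_pos
    by_cases h0 : 0 < r
    · have : -Real.pi < r := by linarith
      simp [h0, this]
    · simp [h0]

lemma aux_J {E : Type*} [NormedAddCommGroup E] [InnerProductSpace ℝ E] [FiniteDimensional ℝ E]
    [MeasurableSpace E] [BorelSpace E] {m : ℕ} (hm : 1 ≤ m) (hE : Module.finrank ℝ E = m + 1)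
    (z : E) (hz : ‖z‖ = 1) (f : ℝ → ENNReal) (hf : Measurable f) :
    ∫⁻ y in Metric.ball (0 : E) 1, f (⟪z, y⟫ / ‖y‖) =
      (m * volume (Metric.ball (0 : EuclideanSpace ℝ (Fin m)) 1)) *
      (ENNReal.ofReal (1 / (m + 1)) *
      ∫⁻ t in Set.Ioo (-1 : ℝ) 1, ENNReal.ofReal ((1 - t ^ 2) ^ (((m : ℝ) - 2) / 2)) * f t) := by
  let V := EuclideanSpace ℝ (Fin m)
  obtain ⟨L, hL⟩ := aux_isom (E := WithLp 2 (ℝ × V)) (F := E)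
    (by rw [hE, (WithLp.linearEquiv 2 ℝ (ℝ × V)).finrank_eq]; simp [V]; ring)
    (WithLp.toLp 2 ((1 : ℝ), (0 : V))) z (by rw [hz, WithLp.prod_norm_eq_of_L2]; simp)
  have hmp : MeasurePreserving (fun p : ℝ × V => L (WithLp.toLp 2 p)) :=
    L.measurePreserving.comp (WithLp.volume_preserving_toLp ℝ V)
  let H : ℝ → ℝ → ENNReal := fun s r => if s ^ 2 + r ^ 2 < 1 then f (s / √(s ^ 2 + r ^ 2)) else 0
  have hH : Measurable (fun p : ℝ × ℝ => H p.1 p.2) := by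
    refine Measurable.ite (measurableSet_lt (by fun_prop) measurable_const) ?_ measurable_const
    exact hf.comp (by fun_prop)
  rw [← lintegral_indicator Metric.isOpen_ball.measurableSet, ← hmp.lintegral_comp]
  · have : ∀ p : ℝ × V, (Metric.ball (0 : E) 1).indicator (fun y => f (⟪z, y⟫ / ‖y‖))
        (L (WithLp.toLp 2 p)) = H p.1 ‖p.2‖ := by
      intro p
      have hn : ‖L (WithLp.toLp 2 p)‖ = √(p.1 ^ 2 + ‖p.2‖ ^ 2) := by
        rw [L.norm_map, WithLp.prod_norm_eq_of_L2]; simp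
      have hi : ⟪z, L (WithLp.toLp 2 p)⟫ = p.1 := by
        rw [← hL, L.inner_map_map]; simp [WithLp.prod_inner_apply]
      simp only [Set.indicator, mem_ball_zero_iff, hn, hi, H]
      congr 1
      rw [Real.sqrt_lt' one_pos]; simp
    simp only [this]
    have hH2 : Measurable (fun p : ℝ × V => H p.1 ‖p.2‖) :=
      hH.comp (g := fun p : ℝ × ℝ => H p.1 p.2) (f := fun p : ℝ × V => (p.1, ‖p.2‖)) (by fun_prop)
    rw [Measure.volume_eq_prod, lintegral_prod _
      hH2.aemeasurable, aux_cos m hm, ← aux_polar m hm f hf,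
      ← lintegral_const_mul']
    · refine lintegral_congr fun s => ?_
      exact aux_radial hm _ (hH.comp (f := fun r => (s, r)) (by fun_prop))
    · exact ENNReal.mul_ne_top (by simp) measure_ball_lt_top.ne
  · refine Measurable.indicator ?_ Metric.isOpen_ball.measurableSet
    exact hf.comp (by fun_prop)

lemma aux_const {E : Type*} [NormedAddCommGroup E] [InnerProductSpace ℝ E] [FiniteDimensional ℝ E]
    [MeasurableSpace E] [BorelSpace E] {m : ℕ} (hm : 1 ≤ m) (hE : Module.finrank ℝ E = m + 1) :
    (m * volume (Metric.ball (0 : EuclideanSpace ℝ (Fin m)) 1)) * ENNReal.ofReal (1 / (m + 1)) =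
    volume (Metric.ball (0 : E) 1) * ENNReal.ofReal
      (Real.Gamma (((m : ℝ) + 1) / 2) / (Real.sqrt Real.pi * Real.Gamma ((m : ℝ) / 2))) := by
  have : Nonempty (Fin m) := ⟨⟨0, hm⟩⟩
  have : Nontrivial E := Module.nontrivial_of_finrank_pos (R := ℝ) (by omega)
  have hm0 : (0:ℝ) < m := by exact_mod_cast hm
  rw [EuclideanSpace.volume_ball, InnerProductSpace.volume_ball, hE, ← ENNReal.ofReal_natCast]
  simp only [ENNReal.ofReal_one, one_pow, one_mul, Fintype.card_fin]
  have g1 : 0 < Real.Gamma ((m : ℝ) / 2) := Real.Gamma_pos_of_pos (by positivity)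
  have g2 : 0 < Real.Gamma (((m : ℝ) + 1) / 2) := Real.Gamma_pos_of_pos (by positivity)
  have g3 : Real.Gamma ((m : ℝ) / 2 + 1) = (m / 2) * Real.Gamma ((m : ℝ) / 2) :=
    Real.Gamma_add_one (by positivity)
  have g4 : Real.Gamma (((m + 1 : ℕ) : ℝ) / 2 + 1) = ((m + 1) / 2) * Real.Gamma (((m : ℝ) + 1) / 2) := by
    push_cast
    exact Real.Gamma_add_one (by positivity)
  have hp : 0 < √Real.pi := Real.sqrt_pos.2 Real.pi_pos
  rw [g3, g4, ← ENNReal.ofReal_mul (by positivity), ← ENNReal.ofReal_mul (by positivity),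
    ← ENNReal.ofReal_mul (by positivity)]
  congr 1
  rw [pow_succ]
  field_simp

lemma aux_marginal {m : ℕ} (hm : 1 ≤ m) (f : ℝ → ENNReal) (hf : Measurable f) :
    ∫⁻ t, f t ∂(sphereMarginal (m + 1)) =
      ENNReal.ofReal
        (Real.Gamma (((m : ℝ) + 1) / 2) / (Real.sqrt Real.pi * Real.Gamma ((m : ℝ) / 2))) *
      ∫⁻ t in Set.Ioo (-1 : ℝ) 1, ENNReal.ofReal ((1 - t ^ 2) ^ (((m : ℝ) - 2) / 2)) * f t := by
  rw [sphereMarginal, lintegral_withDensity_eq_lintegral_mul _ (by fun_prop) hf,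
    ← lintegral_const_mul' _ _ ENNReal.ofReal_ne_top]
  refine setLIntegral_congr_fun measurableSet_Ioo fun t ht => ?_
  have h1 : 0 ≤ 1 - t ^ 2 := by nlinarith [ht.1, ht.2]
  simp only [Pi.mul_apply]
  rw [← mul_assoc, mul_comm (ENNReal.ofReal (_ / _)), ENNReal.ofReal_mul (Real.rpow_nonneg h1 _)]
  push_cast
  congr 5
  · ring
  · ring_nf

lemma aux_law {m : ℕ} (hm : 1 ≤ m) (w v : EuclideanSpace ℝ (Fin (m + 2))) (hw : ‖w‖ = 1)
    (hv : ‖v‖ = 1) (hvw : ⟪v, w⟫ = 0)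
    (ν : Measure (EuclideanSpace ℝ (Fin (m + 2)))) [IsProbabilityMeasure ν]
    (hsupp : ∀ᵐ z ∂ν, ‖z‖ = 1 ∧ ⟪z, w⟫ = 0)
    (hinv : ∀ Q : EuclideanSpace ℝ (Fin (m + 2)) ≃ₗᵢ[ℝ] EuclideanSpace ℝ (Fin (m + 2)),
      Q w = w → Measure.map Q ν = ν) :
    Measure.map (fun z => ⟪z, v⟫) ν = sphereMarginal (m + 1) := by
  have hmeas : Measurable (fun z : EuclideanSpace ℝ (Fin (m + 2)) => ⟪z, v⟫) := by fun_prop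
  refine Measure.ext_of_lintegral _ fun f hf => ?_
  rw [lintegral_map hf hmeas, aux_marginal hm f hf]
  let E := (Submodule.span ℝ {w})ᗮ
  have hw0 : w ≠ 0 := by rintro rfl; simp at hw
  have hE : Module.finrank ℝ E = m + 1 := by
    have : Fact (Module.finrank ℝ (EuclideanSpace ℝ (Fin (m + 2))) = (m + 1) + 1) := ⟨by simp⟩
    exact Submodule.finrank_orthogonal_span_singleton hw0
  have hmemE : ∀ y, y ∈ E ↔ ⟪y, w⟫ = 0 := fun y =>
    Submodule.mem_orthogonal_singleton_iff_inner_left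
  -- invariance
  have key : ∀ y : E, y ≠ 0 → ∫⁻ z, f (⟪z, (y : EuclideanSpace ℝ (Fin (m + 2)))⟫ / ‖y‖) ∂ν =
      ∫⁻ z, f ⟪z, v⟫ ∂ν := by
    intro y hy
    have hy0 : ‖y‖ ≠ 0 := norm_ne_zero_iff.2 hy
    set y' : EuclideanSpace ℝ (Fin (m + 2)) := ‖y‖⁻¹ • (y : EuclideanSpace ℝ (Fin (m + 2))) with hy'
    have hyn : ‖y'‖ = 1 := by
      rw [hy', norm_smul, norm_inv, norm_norm, Submodule.coe_norm]
      exact inv_mul_cancel₀ hy0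
    have hyw : ⟪y', w⟫ = 0 := by
      rw [hy', real_inner_smul_left, (hmemE _).1 y.2, mul_zero]
    let Q := Submodule.reflection (Submodule.span ℝ {v - y'})ᗮ
    have hQv : Q v = y' := Submodule.reflection_sub (by rw [hv, hyn])
    have hQw : Q w = w := by
      apply Submodule.reflection_mem_subspace_eq_self
      rw [Submodule.mem_orthogonal_singleton_iff_inner_left, real_inner_comm, inner_sub_left,
        hvw, hyw, sub_zero]
    have h1 : ∀ z : EuclideanSpace ℝ (Fin (m + 2)),
        ⟪z, (y : EuclideanSpace ℝ (Fin (m + 2)))⟫ / ‖y‖ = ⟪z, y'⟫ := by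
      intro z
      rw [hy', real_inner_smul_right]; ring
    simp only [h1]
    nth_rewrite 1 [← hinv Q hQw]
    have hm3 : Measurable (fun z : EuclideanSpace ℝ (Fin (m + 2)) => f ⟪z, y'⟫) :=
      hf.comp (by fun_prop)
    rw [lintegral_map hm3 Q.continuous.measurable]
    refine lintegral_congr fun z => ?_
    rw [← hQv, Q.inner_map_map]
  have hne : volume (Metric.ball (0 : E) 1) ≠ 0 := (Metric.measure_ball_pos _ _ one_pos).ne'
  have hnt : volume (Metric.ball (0 : E) 1) ≠ ⊤ := measure_ball_lt_top.ne
  have hnontriv : Nontrivial E := Module.nontrivial_of_finrank_pos (R := ℝ) (by omega)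
  rw [← ENNReal.mul_right_inj hne hnt, ← mul_assoc, ← aux_const hm hE, mul_assoc]
  have s1 : volume (Metric.ball (0 : E) 1) * ∫⁻ z, f ⟪z, v⟫ ∂ν =
      ∫⁻ y in Metric.ball (0 : E) 1,
        ∫⁻ z, f (⟪z, (y : EuclideanSpace ℝ (Fin (m + 2)))⟫ / ‖y‖) ∂ν := by
    rw [mul_comm, ← setLIntegral_const]
    refine lintegral_congr_ae ?_
    have : ∀ᵐ y : E ∂(volume.restrict (Metric.ball (0 : E) 1)), y ≠ 0 :=
      ae_restrict_of_ae (Measure.ae_ne volume 0)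
    filter_upwards [this] with y hy using (key y hy).symm
  rw [s1, lintegral_lintegral_swap]
  · have s2 : ∀ᵐ z ∂ν, ∫⁻ y in Metric.ball (0 : E) 1,
        f (⟪z, (y : EuclideanSpace ℝ (Fin (m + 2)))⟫ / ‖y‖) =
        (m * volume (Metric.ball (0 : EuclideanSpace ℝ (Fin m)) 1)) *
        (ENNReal.ofReal (1 / (m + 1)) *
        ∫⁻ t in Set.Ioo (-1 : ℝ) 1, ENNReal.ofReal ((1 - t ^ 2) ^ (((m : ℝ) - 2) / 2)) * f t) := by
      filter_upwards [hsupp] with z hz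
      exact aux_J hm hE ⟨z, (hmemE z).2 hz.2⟩ hz.1 f hf
    rw [lintegral_congr_ae s2]
    simp
  · refine Measurable.aemeasurable ?_
    exact hf.comp (by fun_prop)

lemma aux_decomp {m : ℕ} (w u : EuclideanSpace ℝ (Fin (m + 2))) (hw : ‖w‖ = 1)
    (hu : ‖u‖ = 1) : ∃ v : EuclideanSpace ℝ (Fin (m + 2)), ‖v‖ = 1 ∧ ⟪v, w⟫ = 0 ∧
      u = ⟪w, u⟫ • w + √(1 - ⟪w, u⟫ ^ 2) • v := by
  set x := u - ⟪w, u⟫ • w with hx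
  have hww : ⟪w, w⟫ = 1 := by rw [real_inner_self_eq_norm_sq, hw]; norm_num
  have huu : ⟪u, u⟫ = 1 := by rw [real_inner_self_eq_norm_sq, hu]; norm_num
  have hxw : ⟪x, w⟫ = 0 := by
    rw [hx, inner_sub_left, real_inner_smul_left, hww, real_inner_comm]; ring
  have hxn : ‖x‖ ^ 2 = 1 - ⟪w, u⟫ ^ 2 := by
    rw [← real_inner_self_eq_norm_sq, hx, inner_sub_left, inner_sub_right, inner_sub_right,
      real_inner_smul_left, real_inner_smul_right, real_inner_smul_left, real_inner_smul_right,
      hww, huu, real_inner_comm w u]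
    ring
  have hs : √(1 - ⟪w, u⟫ ^ 2) = ‖x‖ := by rw [← hxn, Real.sqrt_sq (norm_nonneg _)]
  rw [hs]
  by_cases h0 : x = 0
  · have hw0 : w ≠ 0 := by rintro rfl; simp at hw
    have hE : Module.finrank ℝ (Submodule.span ℝ {w})ᗮ = m + 1 := by
      have : Fact (Module.finrank ℝ (EuclideanSpace ℝ (Fin (m + 2))) = (m + 1) + 1) := ⟨by simp⟩
      exact Submodule.finrank_orthogonal_span_singleton hw0
    have : Nontrivial (Submodule.span ℝ {w})ᗮ :=
      Module.nontrivial_of_finrank_pos (R := ℝ) (by omega)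
    obtain ⟨v, hv⟩ := exists_norm_eq (Submodule.span ℝ {w})ᗮ (zero_le_one (α := ℝ))
    refine ⟨v, hv, Submodule.mem_orthogonal_singleton_iff_inner_left.1 v.2, ?_⟩
    rw [h0, norm_zero, zero_smul, add_zero]
    exact sub_eq_zero.1 h0
  · have hn : ‖x‖ ≠ 0 := norm_ne_zero_iff.2 h0
    refine ⟨‖x‖⁻¹ • x, ?_, ?_, ?_⟩
    · rw [norm_smul, norm_inv, norm_norm, inv_mul_cancel₀ hn]
    · rw [real_inner_smul_left, hxw, mul_zero]
    · rw [smul_inv_smul₀ hn, hx]; abel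

/-- Smoothing preserves single-index structure: for `μ_w` uniform on the unit sphere of `w^⊥`
(characterized as a probability measure supported on `{‖z‖=1, z⊥w}` invariant under isometries
fixing `w`),
`E_{z∼μ_w}[g((w+λz)/‖w+λz‖ · u)] = E_{t∼z_1(S^{d-2})}[g((α + λt√(1-α²))/√(1+λ²))]`
with `α = w·u`. -/
theorem smoothing_single_index {d : ℕ} (hd : 3 ≤ d) (lam : ℝ) (hlam : 0 < lam)
    (g : ℝ → ℝ) (hg : Measurable g)
    (w u : EuclideanSpace ℝ (Fin d)) (hw : ‖w‖ = 1) (hu : ‖u‖ = 1)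
    (ν : Measure (EuclideanSpace ℝ (Fin d))) [IsProbabilityMeasure ν]
    (hsupp : ∀ᵐ z ∂ν, ‖z‖ = 1 ∧ ⟪z, w⟫ = 0)
    (hinv : ∀ Q : EuclideanSpace ℝ (Fin d) ≃ₗᵢ[ℝ] EuclideanSpace ℝ (Fin d),
      Q w = w → Measure.map Q ν = ν) :
    ∫ z, g (⟪(‖w + lam • z‖)⁻¹ • (w + lam • z), u⟫) ∂ν =
      ∫ t, g ((⟪w, u⟫ + lam * t * Real.sqrt (1 - ⟪w, u⟫ ^ 2)) / Real.sqrt (1 + lam ^ 2))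
        ∂(sphereMarginal (d - 1)) := by
  obtain ⟨m, rfl⟩ := Nat.exists_eq_add_of_le' (show 2 ≤ d by omega)
  have hm : 1 ≤ m := by omega
  obtain ⟨v, hv, hvw, huv⟩ := aux_decomp w u hw hu
  have hlaw := aux_law hm w v hw hv hvw ν hsupp hinv
  have hww : ⟪w, w⟫ = 1 := by rw [real_inner_self_eq_norm_sq, hw]; norm_num
  rw [show m + 2 - 1 = m + 1 from rfl, ← hlaw]
  set α := ⟪w, u⟫ with hα
  have hm2 : Measurable (fun t : ℝ => g ((α + lam * t * √(1 - α ^ 2)) / √(1 + lam ^ 2))) :=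
    hg.comp (by fun_prop)
  have hm1 : Measurable (fun z : EuclideanSpace ℝ (Fin (m + 2)) => ⟪z, v⟫) := by fun_prop
  rw [integral_map hm1.aemeasurable hm2.aestronglyMeasurable]
  refine integral_congr_ae ?_
  filter_upwards [hsupp] with z hz
  have hn : ‖w + lam • z‖ = √(1 + lam ^ 2) := by
    rw [eq_comm, Real.sqrt_eq_iff_mul_self_eq (by positivity) (norm_nonneg _),
      ← real_inner_self_eq_norm_mul_norm, inner_add_left, inner_add_right, inner_add_right,
      real_inner_smul_left, real_inner_smul_right, real_inner_smul_left, real_inner_smul_right,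
      hww, real_inner_comm z w, hz.2, real_inner_self_eq_norm_sq z, hz.1]
    ring
  have hzu : ⟪z, u⟫ = √(1 - α ^ 2) * ⟪z, v⟫ := by
    rw [huv, inner_add_right, real_inner_smul_right, real_inner_smul_right, hz.2]; ring
  congr 1
  rw [real_inner_smul_left, hn, inner_add_left, real_inner_smul_left, hzu, ← hα]
  ring
end

section
/- (Smoothed Hermite tensor) For w ∈ S^{d−1}, 𝓛_λ(He_k(w·x)) = ⟨He_k(x), T_k(w)⟩ where T_k(w) = (1+λ²)^{−k/2} Σ_{j=0}^{⌊k/2⌋} C(k,2j) · sym(w^{⊗(k−2j)} ⊗ (P_w^⊥)^{⊗j}) · λ^{2j} ν_j^{(d−1)}. -/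
open MeasureTheory Finset
open scoped RealInnerProductSpace

noncomputable def He (k : ℕ) (x : ℝ) : ℝ := Polynomial.aeval x (Polynomial.hermite k)

noncomputable def symTensor {d k : ℕ} (T : (Fin k → Fin d) → ℝ) : (Fin k → Fin d) → ℝ :=
  fun i => (1 / (Nat.factorial k : ℝ)) * ∑ π : Equiv.Perm (Fin k), T (i ∘ π)

def tget {d k : ℕ} [NeZero d] (i : Fin k → Fin d) (a : ℕ) : Fin d :=
  if h : a < k then i ⟨a, h⟩ else 0

/-- The `k`-tensor `w^{⊗(k−2j)} ⊗ P^{⊗j}` (indices: `k−2j` copies of `w` followed by `j`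
pairs of indices of the matrix `P`). -/
def mixedTensor {d : ℕ} [NeZero d] (w : Fin d → ℝ) (P : Fin d → Fin d → ℝ) (k j : ℕ) :
    (Fin k → Fin d) → ℝ :=
  fun i => (∏ a ∈ Finset.range (k - 2 * j), w (tget i a)) *
    ∏ b ∈ Finset.range j, P (tget i (k - 2 * j + 2 * b)) (tget i (k - 2 * j + 2 * b + 1))

noncomputable def nuConst (m j : ℕ) : ℝ :=
  (Nat.doubleFactorial (2 * j - 1) : ℝ) * ∏ i ∈ Finset.range j, 1 / ((m : ℝ) + 2 * i)


theorem sh_sum_sym {d k : ℕ} (H T : (Fin k → Fin d) → ℝ)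
    (Hsym : ∀ (π : Equiv.Perm (Fin k)) (i : Fin k → Fin d), H (i ∘ π) = H i) :
    ∑ i, H i * symTensor T i = ∑ i, H i * T i := by
  have h1 : ∀ π : Equiv.Perm (Fin k), ∑ i, H i * T (i ∘ π) = ∑ i, H i * T i := by
    intro π
    rw [← Equiv.sum_comp (Equiv.arrowCongr π.symm (Equiv.refl (Fin d))) (fun i => H i * T i)]
    refine Finset.sum_congr rfl fun i _ => ?_
    have : (Equiv.arrowCongr π.symm (Equiv.refl (Fin d))) i = i ∘ π := by
      ext a; simp [Equiv.arrowCongr]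
    rw [this, Hsym]
  unfold symTensor
  calc _ = (1 / (Nat.factorial k : ℝ)) * ∑ π : Equiv.Perm (Fin k), ∑ i, H i * T (i ∘ π) := by
        rw [Finset.sum_comm, Finset.mul_sum]
        refine Finset.sum_congr rfl fun i _ => ?_
        rw [← Finset.mul_sum]; ring
    _ = _ := by
        simp only [h1, Finset.sum_const, Finset.card_univ, Fintype.card_perm, Fintype.card_fin,
          nsmul_eq_mul]
        have : (Nat.factorial k : ℝ) ≠ 0 := by positivity
        field_simp

theorem sh_tget_lt {d k : ℕ} [NeZero d] (i : Fin k → Fin d) (a : ℕ) (h : a < k) :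
    tget i a = i ⟨a, h⟩ := by simp [tget, h]

theorem sh_contract {d : ℕ} [NeZero d] (w v : Fin d → ℝ) (P : Fin d → Fin d → ℝ) (m j : ℕ) :
    ∑ i : Fin (m + 2 * j) → Fin d, mixedTensor w P (m + 2 * j) j i * ∏ a, v (i a) =
      (∑ a, w a * v a) ^ m * (∑ a, ∑ b, P a b * (v a * v b)) ^ j := by
  induction j with
  | zero =>
    have : ∀ i : Fin m → Fin d, mixedTensor w P m 0 i * ∏ a, v (i a) = ∏ a, (w (i a) * v (i a)) := by
      intro i
      rw [Finset.prod_mul_distrib]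
      congr 1
      simp only [mixedTensor, Finset.range_zero, Finset.prod_empty, mul_one, Nat.mul_zero, Nat.sub_zero]
      rw [← Fin.prod_univ_eq_prod_range (fun a => w (tget i a)) m]
      exact Finset.prod_congr rfl fun a _ => by rw [sh_tget_lt i a a.2]
    simp only [Nat.mul_zero, Nat.add_zero, pow_zero, mul_one, this]
    have h := (Finset.prod_univ_sum (fun _ : Fin m => (Finset.univ : Finset (Fin d))) (fun _ a => w a * v a)).symm
    simpa using h
  | succ j ih =>
    have key : ∀ (i : Fin (m + 2 * j) → Fin d) (a b : Fin d),
        mixedTensor w P (m + 2 * (j + 1)) (j + 1)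
          (Fin.snoc (α := fun _ => Fin d) (Fin.snoc (α := fun _ => Fin d) i a) b : Fin (m + 2 * j + 1 + 1) → Fin d) =
        mixedTensor w P (m + 2 * j) j i * P a b := by
      intro i a b
      set t : Fin (m + 2 * j + 1 + 1) → Fin d :=
        Fin.snoc (α := fun _ => Fin d) (Fin.snoc (α := fun _ => Fin d) i a) b with ht
      have t1 : ∀ n, n < m + 2 * j → tget t n = tget i n := by
        intro n hn
        rw [sh_tget_lt _ _ hn, sh_tget_lt t n (by omega)]
        simp [ht, Fin.snoc, hn, show n < m + 2 * j + 1 by omega]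
      have t2 : tget t (m + 2 * j) = a := by
        rw [sh_tget_lt t _ (by omega)]; simp [ht, Fin.snoc]
      have t3 : tget t (m + 2 * j + 1) = b := by
        rw [sh_tget_lt t _ (by omega)]; simp [ht, Fin.snoc]
      change (∏ a ∈ Finset.range (m + 2 * (j + 1) - 2 * (j + 1)), w (tget t a)) *
        ∏ b ∈ Finset.range (j + 1), P (tget t (m + 2 * (j + 1) - 2 * (j + 1) + 2 * b))
          (tget t (m + 2 * (j + 1) - 2 * (j + 1) + 2 * b + 1)) = _
      unfold mixedTensor
      simp only [Nat.add_sub_cancel]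
      rw [Finset.prod_range_succ, t2, t3, ← mul_assoc]
      congr 2
      · refine Finset.prod_congr rfl fun n hn => ?_
        rw [t1 n (by have := Finset.mem_range.1 hn; omega)]
      · refine Finset.prod_congr rfl fun n hn => ?_
        have := Finset.mem_range.1 hn
        rw [t1 _ (by omega), t1 _ (by omega)]
    change ∑ i : Fin (m + 2 * j + 1 + 1) → Fin d, mixedTensor w P (m + 2 * (j + 1)) (j + 1) i * ∏ a : Fin (m + 2 * j + 1 + 1), v (i a) = _
    rw [← Equiv.sum_comp (Fin.snocEquiv (fun _ => Fin d)), Fintype.sum_prod_type]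
    simp_rw [← Equiv.sum_comp (Fin.snocEquiv (fun _ : Fin (m + 2 * j + 1) => Fin d)), Fintype.sum_prod_type]
    simp only [Fin.snocEquiv, Equiv.coe_fn_mk, key, Fin.prod_univ_castSucc, Fin.snoc_castSucc, Fin.snoc_last]
    rw [pow_succ, ← mul_assoc, ← ih, Finset.sum_comm, Finset.mul_sum]
    refine Finset.sum_congr rfl fun a _ => ?_
    rw [Finset.mul_sum]
    refine Finset.sum_congr rfl fun b _ => ?_
    rw [Finset.sum_mul]
    refine Finset.sum_congr rfl fun i _ => ?_
    ring

theorem sh_even_sum (f : ℕ → ℝ) (hf : ∀ n, f (2 * n + 1) = 0) (k : ℕ) :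
    ∑ n ∈ Finset.range (k + 1), f n = ∑ j ∈ Finset.range (k / 2 + 1), f (2 * j) := by
  induction k with
  | zero => simp
  | succ k ih =>
    rw [Finset.sum_range_succ, ih]
    rcases Nat.even_or_odd' k with ⟨c, rfl | rfl⟩
    · rw [hf, show (2 * c + 1) / 2 = 2 * c / 2 by omega, add_zero]
    · rw [show (2 * c + 1 + 1) / 2 = (2 * c + 1) / 2 + 1 by omega, Finset.sum_range_succ _ (_ + 1)]
      congr 2; omega

theorem sh_nu_succ (m j : ℕ) : nuConst m (j + 1) = nuConst m j * ((2 * j + 1) / (m + 2 * j)) := by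
  unfold nuConst
  rw [Finset.prod_range_succ]
  have : (Nat.doubleFactorial (2 * (j + 1) - 1) : ℝ) = (2 * j + 1) * Nat.doubleFactorial (2 * j - 1) := by
    cases j with
    | zero => simp
    | succ n =>
      rw [show 2 * (n + 1 + 1) - 1 = (2 * n + 1) + 2 by omega, Nat.doubleFactorial_add_two,
        show 2 * (n + 1) - 1 = 2 * n + 1 by omega]
      push_cast; ring
  rw [this]; ring

theorem sh_polar {d k : ℕ} (H C : (Fin k → Fin d) → ℝ)
    (Hsym : ∀ (π : Equiv.Perm (Fin k)) (i : Fin k → Fin d), H (i ∘ π) = H i)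
    (hC : ∀ v : Fin d → ℝ, ∑ i, C i * ∏ a, v (i a) = 0) :
    ∑ i, H i * C i = 0 := by
  classical
  let m : (Fin k → Fin d) → (Fin d →₀ ℕ) := fun i => ∑ a, Finsupp.single (i a) 1
  have hm : ∀ i i', m i = m i' → H i = H i' := by
    intro i i' h
    have hcard : ∀ (f : Fin k → Fin d) (b : Fin d), m f b = Fintype.card {a // f a = b} := by
      intro f b
      simp only [m, Finsupp.finsetSum_apply, Finsupp.single_apply]
      rw [Fintype.card_subtype, Finset.card_filter]
    have e : ∀ b, {a // i a = b} ≃ {a // i' a = b} := fun b =>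
      Fintype.equivOfCardEq (by rw [← hcard, ← hcard, h])
    have hσ : i = i' ∘ (Equiv.ofFiberEquiv e : Equiv.Perm (Fin k)) := by
      funext a
      exact (Equiv.ofFiberEquiv_map e a).symm
    rw [hσ, Hsym]
  let p : MvPolynomial (Fin d) ℝ := ∑ i, MvPolynomial.monomial (m i) (C i)
  have hp : p = 0 := by
    apply MvPolynomial.funext
    intro v
    rw [map_zero, ← hC v, map_sum]
    refine Finset.sum_congr rfl fun i _ => ?_
    rw [MvPolynomial.eval_monomial]
    congr 1
    simp only [m]
    rw [← Finsupp.prod_finsetSum_index] <;> simp [pow_add]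
  have hc : ∀ n, ∑ i with m i = n, C i = 0 := by
    intro n
    have := congrArg (MvPolynomial.coeff n) hp
    simp only [p, MvPolynomial.coeff_sum, MvPolynomial.coeff_monomial, MvPolynomial.coeff_zero] at this
    rw [Finset.sum_filter]; exact this
  rw [← Finset.sum_fiberwise_of_maps_to (t := Finset.univ.image m) (g := m) (fun i _ => Finset.mem_image_of_mem m (Finset.mem_univ i))]
  refine Finset.sum_eq_zero fun n hn => ?_
  obtain ⟨i0, -, rfl⟩ := Finset.mem_image.1 hn
  rw [← mul_zero (H i0), ← hc (m i0), Finset.mul_sum]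
  refine Finset.sum_congr rfl fun i hi => ?_
  rw [hm i i0 (Finset.mem_filter.1 hi).2]

theorem sh_integrable {d : ℕ} (ν : Measure (EuclideanSpace ℝ (Fin d))) [IsProbabilityMeasure ν]
    (hs : ∀ᵐ z ∂ν, ‖z‖ = 1) (f : EuclideanSpace ℝ (Fin d) → ℝ) (hf : Continuous f) :
    Integrable f ν := by
  obtain ⟨C, hC⟩ := (isCompact_closedBall (0 : EuclideanSpace ℝ (Fin d)) 1).exists_bound_of_continuousOn
    hf.continuousOn
  refine Integrable.of_bound hf.aestronglyMeasurable C ?_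
  filter_upwards [hs] with z hz
  exact hC z (by simp [hz])

theorem sh_inv {d : ℕ} (w : EuclideanSpace ℝ (Fin d))
    (ν : Measure (EuclideanSpace ℝ (Fin d)))
    (hinv : ∀ Q : EuclideanSpace ℝ (Fin d) ≃ₗᵢ[ℝ] EuclideanSpace ℝ (Fin d),
      Q w = w → Measure.map Q ν = ν)
    (Q : EuclideanSpace ℝ (Fin d) ≃ₗᵢ[ℝ] EuclideanSpace ℝ (Fin d)) (hQ : Q w = w)
    (f : EuclideanSpace ℝ (Fin d) → ℝ) (hf : Continuous f) :
    ∫ z, f (Q z) ∂ν = ∫ z, f z ∂ν := by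
  conv_rhs => rw [← hinv Q hQ]
  rw [integral_map Q.continuous.aemeasurable hf.aestronglyMeasurable]

theorem sh_odd {d : ℕ} (w : EuclideanSpace ℝ (Fin d))
    (ν : Measure (EuclideanSpace ℝ (Fin d)))
    (hsupp : ∀ᵐ z ∂ν, ‖z‖ = 1 ∧ ⟪z, w⟫ = 0)
    (hinv : ∀ Q : EuclideanSpace ℝ (Fin d) ≃ₗᵢ[ℝ] EuclideanSpace ℝ (Fin d),
      Q w = w → Measure.map Q ν = ν)
    (v : EuclideanSpace ℝ (Fin d)) (n : ℕ) :
    ∫ z, ⟪v, z⟫ ^ (2 * n + 1) ∂ν = 0 := by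
  have h := sh_inv w ν hinv ((Submodule.span ℝ {w}).reflection)
    (Submodule.reflection_mem_subspace_eq_self (Submodule.mem_span_singleton_self w))
    (fun z => ⟪v, z⟫ ^ (2 * n + 1)) (by fun_prop)
  have h2 : ∫ z, ⟪v, (Submodule.span ℝ {w}).reflection z⟫ ^ (2 * n + 1) ∂ν
      = ∫ z, - ⟪v, z⟫ ^ (2 * n + 1) ∂ν := by
    apply integral_congr_ae
    filter_upwards [hsupp] with z hz
    have : (Submodule.span ℝ {w}).reflection z = -z := by
      apply Submodule.reflection_mem_subspace_orthogonalComplement_eq_neg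
      rw [Submodule.mem_orthogonal_singleton_iff_inner_left]
      exact hz.2
    simp only [this, inner_neg_right]
    rw [Odd.neg_pow ⟨n, rfl⟩]
  rw [integral_neg] at h2
  linarith

theorem sh_rot {d : ℕ} (w : EuclideanSpace ℝ (Fin d))
    (ν : Measure (EuclideanSpace ℝ (Fin d)))
    (hinv : ∀ Q : EuclideanSpace ℝ (Fin d) ≃ₗᵢ[ℝ] EuclideanSpace ℝ (Fin d),
      Q w = w → Measure.map Q ν = ν)
    (u v : EuclideanSpace ℝ (Fin d)) (huv : ‖u‖ = ‖v‖) (hu : ⟪u, w⟫ = 0) (hv : ⟪v, w⟫ = 0) (n : ℕ) :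
    ∫ z, ⟪u, z⟫ ^ n ∂ν = ∫ z, ⟪v, z⟫ ^ n ∂ν := by
  set Q := (Submodule.span ℝ {u - v})ᗮ.reflection with hQdef
  have hQ : Q w = w := by
    apply Submodule.reflection_mem_subspace_eq_self
    rw [Submodule.mem_orthogonal_singleton_iff_inner_right, inner_sub_left, hu, hv, sub_zero]
  have hQu : Q u = v := Submodule.reflection_sub huv
  rw [← sh_inv w ν hinv Q hQ (fun z => ⟪v, z⟫ ^ n) (by fun_prop)]
  simp only [← hQu, LinearIsometryEquiv.inner_map_map]

theorem sh_coeff2 (j : ℕ) : ((1 + Polynomial.X ^ 2 : Polynomial ℝ) ^ (j + 1)).coeff 2 = j + 1 := by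
  have : (1 + Polynomial.X ^ 2 : Polynomial ℝ) ^ (j + 1)
      = Polynomial.expand ℝ 2 ((1 + Polynomial.X) ^ (j + 1)) := by simp
  rw [this, show 2 = 1 * 2 by rfl, Polynomial.coeff_expand_mul (by norm_num), Polynomial.coeff_one_add_X_pow]
  simp

theorem sh_cross {d : ℕ} (w : EuclideanSpace ℝ (Fin d))
    (ν : Measure (EuclideanSpace ℝ (Fin d))) [IsProbabilityMeasure ν]
    (hsupp : ∀ᵐ z ∂ν, ‖z‖ = 1 ∧ ⟪z, w⟫ = 0)
    (hinv : ∀ Q : EuclideanSpace ℝ (Fin d) ≃ₗᵢ[ℝ] EuclideanSpace ℝ (Fin d),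
      Q w = w → Measure.map Q ν = ν)
    (u e : EuclideanSpace ℝ (Fin d)) (hu1 : ‖u‖ = 1) (he1 : ‖e‖ = 1) (hue : ⟪u, e⟫ = 0)
    (hu : ⟪u, w⟫ = 0) (he : ⟪e, w⟫ = 0) (j : ℕ) :
    (2 * j + 1) * ∫ z, ⟪u, z⟫ ^ (2 * j) * ⟪e, z⟫ ^ 2 ∂ν = ∫ z, ⟪u, z⟫ ^ (2 * (j + 1)) ∂ν := by
  have hs : ∀ᵐ z ∂ν, ‖z‖ = 1 := hsupp.mono fun z hz => hz.1
  set c := ∫ z, ⟪u, z⟫ ^ (2 * (j + 1)) ∂ν with hc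
  set N := 2 * (j + 1) with hN
  let p : Polynomial ℝ := ∑ n ∈ Finset.range (N + 1),
    Polynomial.C ((∫ z, ⟪e, z⟫ ^ n * ⟪u, z⟫ ^ (N - n) ∂ν) * (N.choose n)) * Polynomial.X ^ n
  have hp : p = Polynomial.C c * (1 + Polynomial.X ^ 2) ^ (j + 1) := by
    apply Polynomial.funext
    intro t
    simp only [p, Polynomial.eval_finsetSum, Polynomial.eval_mul, Polynomial.eval_C,
      Polynomial.eval_pow, Polynomial.eval_X, Polynomial.eval_add, Polynomial.eval_one]
    have h1 : ∫ z, ⟪t • e + u, z⟫ ^ N ∂ν = ∑ n ∈ Finset.range (N + 1),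
        (∫ z, ⟪e, z⟫ ^ n * ⟪u, z⟫ ^ (N - n) ∂ν) * (N.choose n) * t ^ n := by
      simp only [inner_add_left, inner_smul_left, add_pow]
      rw [integral_finsetSum _ (fun n _ => sh_integrable ν hs _ (by fun_prop))]
      refine Finset.sum_congr rfl fun n _ => ?_
      rw [mul_assoc, ← integral_mul_const]
      congr 1; ext z
      simp only [conj_trivial]
      ring
    rw [← h1]
    have hn : ‖t • e + u‖ ^ 2 = 1 + t ^ 2 := by
      rw [norm_add_sq_real, inner_smul_left, real_inner_comm, hue, norm_smul, he1, hu1]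
      simp; ring
    rw [sh_rot w ν hinv (t • e + u) (‖t • e + u‖ • u) (by simp [norm_smul, hu1])
      (by simp [inner_add_left, inner_smul_left, hu, he]) (by simp [inner_smul_left, hu])]
    simp only [inner_smul_left, mul_pow, conj_trivial]
    rw [integral_const_mul, ← hc, hN, pow_mul, hn]
    ring
  have h2 := congrArg (fun q => Polynomial.coeff q 2) hp
  simp only [p, Polynomial.finsetSum_coeff, Polynomial.coeff_C_mul, Polynomial.coeff_X_pow, sh_coeff2] at h2
  rw [Finset.sum_eq_single 2 (by intro b _ hb; simp [Ne.symm hb]) (by intro h; simp at h; omega)] at h2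
  have h3 : ((N.choose 2 : ℕ) : ℝ) = (j + 1) * (2 * j + 1) := by
    rw [Nat.cast_choose_two, hN]; push_cast; ring
  rw [h3, if_pos rfl, show N - 2 = 2 * j by omega] at h2
  have h4 : (j + 1 : ℝ) ≠ 0 := by positivity
  have h5 : ∫ z, ⟪u, z⟫ ^ (2 * j) * ⟪e, z⟫ ^ 2 ∂ν = ∫ z, ⟪e, z⟫ ^ 2 * ⟪u, z⟫ ^ (2 * j) ∂ν := by
    congr 1; ext z; ring
  rw [h5]
  apply mul_left_cancel₀ h4
  linarith

theorem sh_moment {d : ℕ} [NeZero d] (hd : 3 ≤ d) (w : EuclideanSpace ℝ (Fin d)) (hw : ‖w‖ = 1)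
    (ν : Measure (EuclideanSpace ℝ (Fin d))) [IsProbabilityMeasure ν]
    (hsupp : ∀ᵐ z ∂ν, ‖z‖ = 1 ∧ ⟪z, w⟫ = 0)
    (hinv : ∀ Q : EuclideanSpace ℝ (Fin d) ≃ₗᵢ[ℝ] EuclideanSpace ℝ (Fin d),
      Q w = w → Measure.map Q ν = ν) :
    ∃ u : EuclideanSpace ℝ (Fin d), ‖u‖ = 1 ∧ ⟪u, w⟫ = 0 ∧
      ∀ j, ∫ z, ⟪u, z⟫ ^ (2 * j) ∂ν = nuConst (d - 1) j := by
  have hs : ∀ᵐ z ∂ν, ‖z‖ = 1 := hsupp.mono fun z hz => hz.1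
  obtain ⟨b, hb⟩ := Orthonormal.exists_orthonormalBasis_extension_of_card_eq (𝕜 := ℝ)
    (E := EuclideanSpace ℝ (Fin d)) (ι := Fin d) (by simp) (v := fun _ => w) (s := {0})
    (by
      constructor
      · intro i; simpa using hw
      · intro i j hij; exact absurd (Subsingleton.elim i j) hij)
  have hb0 : b 0 = w := hb 0 (by simp)
  have h01 : (0 : Fin d) ≠ ⟨1, by omega⟩ := by
    intro h; have := congrArg Fin.val h; simp at this
  set o : Fin d := ⟨1, by omega⟩ with ho
  have hin : ∀ i l, i ≠ l → ⟪b i, b l⟫ = 0 := fun i l h => b.orthonormal.2 h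
  have hbn : ∀ i, ‖b i‖ = 1 := fun i => b.orthonormal.1 i
  have hbw : ∀ i, i ≠ 0 → ⟪b i, w⟫ = 0 := fun i hi => by rw [← hb0]; exact hin i 0 hi
  refine ⟨b o, hbn o, hbw o h01.symm, ?_⟩
  intro j
  induction j with
  | zero => simp [nuConst]
  | succ j ih =>
    rw [sh_nu_succ, ← ih]
    set c := ∫ z, ⟪b o, z⟫ ^ (2 * (j + 1)) ∂ν with hc
    have hcross : ∀ i, i ≠ 0 → i ≠ o → ∫ z, ⟪b o, z⟫ ^ (2 * j) * ⟪b i, z⟫ ^ 2 ∂ν = c / (2 * j + 1) := by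
      intro i hi0 hio
      have := sh_cross w ν hsupp hinv (b o) (b i) (hbn o) (hbn i) (hin _ _ hio.symm)
        (hbw o h01.symm) (hbw i hi0) j
      rw [eq_div_iff (by positivity), ← hc] at *
      linarith
    have hsum : ∫ z, ⟪b o, z⟫ ^ (2 * j) ∂ν = ∑ i, ∫ z, ⟪b o, z⟫ ^ (2 * j) * ⟪b i, z⟫ ^ 2 ∂ν := by
      rw [← integral_finsetSum _ (fun n _ => sh_integrable ν hs _ (by fun_prop))]
      apply integral_congr_ae
      filter_upwards [hs] with z hz
      have := b.sum_sq_norm_inner_right z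
      simp only [Real.norm_eq_abs, sq_abs, hz] at this
      rw [← Finset.mul_sum, this]; simp
    have h0 : ∫ z, ⟪b 0, z⟫ ^ 2 * ⟪b o, z⟫ ^ (2 * j) ∂ν = 0 := by
      rw [integral_eq_zero_of_ae]
      filter_upwards [hsupp] with z hz
      rw [hb0, real_inner_comm, hz.2]; simp
    have hterm : ∀ i, ∫ z, ⟪b o, z⟫ ^ (2 * j) * ⟪b i, z⟫ ^ 2 ∂ν =
        c / (2 * j + 1) - (if i = 0 then c / (2 * j + 1) else 0)
          + (if i = o then c - c / (2 * j + 1) else 0) := by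
      intro i
      by_cases hi0 : i = 0
      · subst hi0
        simp only [if_true, if_neg h01]
        rw [sub_self, add_zero, ← h0]
        congr 1; ext z; ring
      · by_cases hio : i = o
        · rw [if_neg hi0, if_pos hio, hio]
          rw [hc]
          simp only [← pow_add, mul_add, mul_one]
          ring
        · rw [if_neg hi0, if_neg hio, hcross i hi0 hio]; ring
    simp only [hterm, Finset.sum_add_distrib, Finset.sum_sub_distrib, Finset.sum_ite_eq',
      Finset.mem_univ, if_true, Finset.sum_const, Finset.card_univ, Fintype.card_fin, nsmul_eq_mul] at hsum
    rw [hsum]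
    have hd1 : ((d - 1 : ℕ) : ℝ) = d - 1 := by rw [Nat.cast_sub (by omega)]; simp
    have hd2 : (3 : ℝ) ≤ d := by exact_mod_cast hd
    rw [hd1]
    have p1 : (2 * j + 1 : ℝ) ≠ 0 := by positivity
    have p2 : (d - 1 + 2 * j : ℝ) ≠ 0 := by
      have : (0 : ℝ) ≤ j := by positivity
      linarith
    field_simp
    ring

theorem sh_even {d : ℕ} [NeZero d] (hd : 3 ≤ d) (w : EuclideanSpace ℝ (Fin d)) (hw : ‖w‖ = 1)
    (ν : Measure (EuclideanSpace ℝ (Fin d))) [IsProbabilityMeasure ν]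
    (hsupp : ∀ᵐ z ∂ν, ‖z‖ = 1 ∧ ⟪z, w⟫ = 0)
    (hinv : ∀ Q : EuclideanSpace ℝ (Fin d) ≃ₗᵢ[ℝ] EuclideanSpace ℝ (Fin d),
      Q w = w → Measure.map Q ν = ν) (v : EuclideanSpace ℝ (Fin d)) (j : ℕ) :
    ∫ z, ⟪v, z⟫ ^ (2 * j) ∂ν = nuConst (d - 1) j * (⟪v, v⟫ - ⟪w, v⟫ ^ 2) ^ j := by
  obtain ⟨u, hu1, huw, hu⟩ := sh_moment hd w hw ν hsupp hinv
  set p := v - ⟪w, v⟫ • w with hp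
  have hww : ⟪w, w⟫ = 1 := by rw [real_inner_self_eq_norm_sq, hw]; simp
  have hpn : ‖p‖ ^ 2 = ⟪v, v⟫ - ⟪w, v⟫ ^ 2 := by
    rw [← real_inner_self_eq_norm_sq, hp]
    simp only [inner_sub_left, inner_sub_right, inner_smul_left, inner_smul_right, conj_trivial, hww,
      real_inner_comm w v]
    ring
  have hpw : ⟪p, w⟫ = 0 := by
    rw [hp, inner_sub_left, inner_smul_left, hww, real_inner_comm]; simp
  have h1 : ∫ z, ⟪v, z⟫ ^ (2 * j) ∂ν = ∫ z, ⟪p, z⟫ ^ (2 * j) ∂ν := by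
    apply integral_congr_ae
    filter_upwards [hsupp] with z hz
    have : ⟪w, z⟫ = 0 := by rw [real_inner_comm]; exact hz.2
    rw [hp, inner_sub_left, inner_smul_left, this]; simp
  rw [h1, sh_rot w ν hinv p (‖p‖ • u) (by simp [norm_smul, hu1]) hpw (by simp [inner_smul_left, huw])]
  simp only [inner_smul_left, mul_pow, conj_trivial]
  rw [integral_const_mul, hu, pow_mul, hpn]
  ring

theorem sh_poly {d k : ℕ} [NeZero d] (hd : 3 ≤ d) (lam : ℝ)
    (w : EuclideanSpace ℝ (Fin d)) (hw : ‖w‖ = 1)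
    (ν : Measure (EuclideanSpace ℝ (Fin d))) [IsProbabilityMeasure ν]
    (hsupp : ∀ᵐ z ∂ν, ‖z‖ = 1 ∧ ⟪z, w⟫ = 0)
    (hinv : ∀ Q : EuclideanSpace ℝ (Fin d) ≃ₗᵢ[ℝ] EuclideanSpace ℝ (Fin d),
      Q w = w → Measure.map Q ν = ν) (v : EuclideanSpace ℝ (Fin d)) :
    ∫ z, ⟪w + lam • z, v⟫ ^ k ∂ν = ∑ j ∈ Finset.range (k / 2 + 1),
      (k.choose (2 * j) : ℝ) * lam ^ (2 * j) * nuConst (d - 1) j *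
        (⟪w, v⟫ ^ (k - 2 * j) * (⟪v, v⟫ - ⟪w, v⟫ ^ 2) ^ j) := by
  have hs : ∀ᵐ z ∂ν, ‖z‖ = 1 := hsupp.mono fun z hz => hz.1
  have h1 : ∫ z, ⟪w + lam • z, v⟫ ^ k ∂ν = ∑ n ∈ Finset.range (k + 1),
      (k.choose n : ℝ) * lam ^ n * ⟪w, v⟫ ^ (k - n) * ∫ z, ⟪v, z⟫ ^ n ∂ν := by
    have : ∀ z, ⟪w + lam • z, v⟫ ^ k = ∑ n ∈ Finset.range (k + 1),
        (k.choose n : ℝ) * lam ^ n * ⟪w, v⟫ ^ (k - n) * ⟪v, z⟫ ^ n := by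
      intro z
      rw [inner_add_left, add_comm, add_pow]
      refine Finset.sum_congr rfl fun n _ => ?_
      rw [inner_smul_left, real_inner_comm, conj_trivial, mul_pow]
      ring
    simp only [this]
    rw [integral_finsetSum _ (fun n _ => sh_integrable ν hs _ (by fun_prop))]
    exact Finset.sum_congr rfl fun n _ => integral_const_mul _ _
  rw [h1, sh_even_sum _ (fun n => by rw [sh_odd w ν hsupp hinv, mul_zero])]
  refine Finset.sum_congr rfl fun j _ => ?_
  rw [sh_even hd w hw ν hsupp hinv]
  ring

theorem sh_quad {d : ℕ} (w v : EuclideanSpace ℝ (Fin d)) :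
    ∑ a, ∑ b, ((if a = b then (1 : ℝ) else 0) - w a * w b) * (v a * v b) = ⟪v, v⟫ - ⟪w, v⟫ ^ 2 := by
  simp only [PiLp.inner_apply, RCLike.inner_apply, conj_trivial, sq, Finset.sum_mul_sum, sub_mul,
    Finset.sum_sub_distrib, ite_mul, one_mul, zero_mul, Finset.sum_ite_eq, Finset.mem_univ, if_true]
  congr 1
  refine Finset.sum_congr rfl fun a _ => Finset.sum_congr rfl fun b _ => ?_
  ring

theorem sh_key {d k : ℕ} [NeZero d] (hd : 3 ≤ d) (lam : ℝ)
    (w : EuclideanSpace ℝ (Fin d)) (hw : ‖w‖ = 1)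
    (H : (Fin k → Fin d) → ℝ)
    (Hsym : ∀ (π : Equiv.Perm (Fin k)) (i : Fin k → Fin d), H (i ∘ π) = H i)
    (ν : Measure (EuclideanSpace ℝ (Fin d))) [IsProbabilityMeasure ν]
    (hsupp : ∀ᵐ z ∂ν, ‖z‖ = 1 ∧ ⟪z, w⟫ = 0)
    (hinv : ∀ Q : EuclideanSpace ℝ (Fin d) ≃ₗᵢ[ℝ] EuclideanSpace ℝ (Fin d),
      Q w = w → Measure.map Q ν = ν) :
    ∑ i : Fin k → Fin d, H i * ∫ z, ∏ a, (w + lam • z) (i a) ∂ν =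
      ∑ i : Fin k → Fin d, H i * ∑ j ∈ Finset.range (k / 2 + 1),
            (k.choose (2 * j) : ℝ) * lam ^ (2 * j) * nuConst (d - 1) j *
              mixedTensor (fun a => w a)
                (fun a b => (if a = b then (1 : ℝ) else 0) - w a * w b) k j i := by
  have hs : ∀ᵐ z ∂ν, ‖z‖ = 1 := hsupp.mono fun z hz => hz.1
  rw [← sub_eq_zero, ← Finset.sum_sub_distrib]
  simp only [← mul_sub]
  refine sh_polar H _ Hsym ?_
  intro v'
  obtain ⟨v, rfl⟩ : ∃ v : EuclideanSpace ℝ (Fin d), v' = fun a => v a := ⟨WithLp.toLp 2 v', rfl⟩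
  simp only [sub_mul, Finset.sum_sub_distrib]
  rw [sub_eq_zero]
  have hL : ∑ i : Fin k → Fin d, (∫ z, ∏ a, (w + lam • z) (i a) ∂ν) * ∏ a, v (i a) =
      ∫ z, ⟪w + lam • z, v⟫ ^ k ∂ν := by
    simp only [← integral_mul_const]
    rw [← integral_finsetSum _ (fun n _ => sh_integrable ν hs _ (by
      simp only [PiLp.add_apply, PiLp.smul_apply]; fun_prop))]
    congr 1; ext z
    rw [PiLp.inner_apply, Fintype.sum_pow]
    refine Finset.sum_congr rfl fun i _ => ?_
    rw [← Finset.prod_mul_distrib]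
    refine Finset.prod_congr rfl fun a _ => ?_
    simp only [RCLike.inner_apply, conj_trivial]; ring
  rw [hL, sh_poly hd lam w hw ν hsupp hinv]
  simp only [Finset.sum_mul]
  rw [Finset.sum_comm]
  refine Finset.sum_congr rfl fun j hj => ?_
  have hjk : k = (k - 2 * j) + 2 * j := by have := Finset.mem_range.1 hj; omega
  simp only [mul_assoc]
  simp only [← Finset.mul_sum]
  congr 3
  have := sh_contract (fun a => w a) (fun a => v a)
    (fun a b => (if a = b then (1 : ℝ) else 0) - w a * w b) (k - 2 * j) j
  rw [← hjk, sh_quad] at this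
  rw [this]
  congr 2
  rw [PiLp.inner_apply]
  refine Finset.sum_congr rfl fun a _ => ?_
  simp only [RCLike.inner_apply, conj_trivial]; ring

/-- Smoothed Hermite tensor: `𝓛_λ(He_k(w·x)) = ⟨He_k(x), T_k(w)⟩` where
`T_k(w) = (1+λ²)^{−k/2} Σ_j C(k,2j) λ^{2j} ν_j^{(d−1)} sym(w^{⊗(k−2j)} ⊗ (P_w^⊥)^{⊗j})`.
Here the Hermite tensor `He_k(x)` is encoded by a symmetric tensor `H x` satisfying
`⟨H x, u^{⊗k}⟩ = He_k(u·x)` for all unit `u`, and `μ_w` is characterized as in the smoothing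
operator. -/
theorem smoothed_hermite_tensor {d k : ℕ} [NeZero d] (hd : 3 ≤ d) (lam : ℝ) (hlam : 0 < lam)
    (w : EuclideanSpace ℝ (Fin d)) (hw : ‖w‖ = 1)
    (H : EuclideanSpace ℝ (Fin d) → (Fin k → Fin d) → ℝ)
    (Hsym : ∀ x (π : Equiv.Perm (Fin k)) (i : Fin k → Fin d), H x (i ∘ π) = H x i)
    (Hchar : ∀ (u x : EuclideanSpace ℝ (Fin d)), ‖u‖ = 1 →
      ∑ i : Fin k → Fin d, H x i * ∏ a : Fin k, u (i a) = He k ⟪u, x⟫)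
    (ν : Measure (EuclideanSpace ℝ (Fin d))) [IsProbabilityMeasure ν]
    (hsupp : ∀ᵐ z ∂ν, ‖z‖ = 1 ∧ ⟪z, w⟫ = 0)
    (hinv : ∀ Q : EuclideanSpace ℝ (Fin d) ≃ₗᵢ[ℝ] EuclideanSpace ℝ (Fin d),
      Q w = w → Measure.map Q ν = ν)
    (x : EuclideanSpace ℝ (Fin d)) :
    ∫ z, He k ⟪(‖w + lam • z‖)⁻¹ • (w + lam • z), x⟫ ∂ν =
      ∑ i : Fin k → Fin d, H x i *
        ((1 + lam ^ 2) ^ (-(k : ℝ) / 2) *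
          ∑ j ∈ Finset.range (k / 2 + 1),
            (k.choose (2 * j) : ℝ) * lam ^ (2 * j) * nuConst (d - 1) j *
              symTensor (mixedTensor (fun a => w a)
                (fun a b => (if a = b then (1 : ℝ) else 0) - w a * w b) k j) i) := by
  have hs : ∀ᵐ z ∂ν, ‖z‖ = 1 := hsupp.mono fun z hz => hz.1
  have hpos : (0 : ℝ) < 1 + lam ^ 2 := by positivity
  have hcoef : (1 + lam ^ 2) ^ (-(k : ℝ) / 2) = ((Real.sqrt (1 + lam ^ 2))⁻¹) ^ k := by
    rw [Real.sqrt_eq_rpow, ← Real.rpow_neg hpos.le, ← Real.rpow_natCast (_ ^ _) k, ← Real.rpow_mul hpos.le]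
    congr 1; ring
  have hL : ∫ z, He k ⟪(‖w + lam • z‖)⁻¹ • (w + lam • z), x⟫ ∂ν =
      ∫ z, (1 + lam ^ 2) ^ (-(k : ℝ) / 2) * ∑ i : Fin k → Fin d, H x i * ∏ a, (w + lam • z) (i a) ∂ν := by
    apply integral_congr_ae
    filter_upwards [hsupp] with z hz
    have hn : ‖w + lam • z‖ = Real.sqrt (1 + lam ^ 2) := by
      rw [eq_comm, Real.sqrt_eq_iff_mul_self_eq hpos.le (norm_nonneg _), ← sq, norm_add_sq_real,
        inner_smul_right, real_inner_comm, hz.2, norm_smul, hz.1, hw]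
      simp
    have hn0 : ‖w + lam • z‖ ≠ 0 := by rw [hn]; positivity
    rw [← Hchar _ x (by rw [norm_smul, norm_inv, norm_norm, inv_mul_cancel₀ hn0]), hn, hcoef,
      Finset.mul_sum]
    refine Finset.sum_congr rfl fun i _ => ?_
    have hsm : ∀ (c : ℝ) (y : EuclideanSpace ℝ (Fin d)) (b : Fin d), (c • y) b = c * y b :=
      fun c y b => rfl
    rw [Finset.prod_congr rfl (fun a _ => hsm _ (w + lam • z) (i a)), Finset.prod_mul_distrib,
      Finset.prod_const, Finset.card_univ, Fintype.card_fin]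
    ring
  rw [hL, integral_const_mul, integral_finsetSum _ (fun n _ => sh_integrable ν hs _ (by
      simp only [PiLp.add_apply, PiLp.smul_apply]; fun_prop))]
  simp only [integral_const_mul]
  rw [sh_key hd lam w hw (H x) (Hsym x) ν hsupp hinv, Finset.mul_sum]
  simp only [Finset.mul_sum]
  rw [Finset.sum_comm]
  conv_rhs => rw [Finset.sum_comm]
  refine Finset.sum_congr rfl fun j _ => ?_
  have h := sh_sum_sym (H x) (mixedTensor (fun a => w a)
    (fun a b => (if a = b then (1 : ℝ) else 0) - w a * w b) k j) (Hsym x)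
  have h2 := congrArg (fun t => (1 + lam ^ 2) ^ (-(k : ℝ) / 2) *
    ((k.choose (2 * j) : ℝ) * lam ^ (2 * j) * nuConst (d - 1) j) * t) h
  simp only [Finset.mul_sum] at h2
  refine Eq.trans ?_ (h2.symm.trans ?_)
  · exact Finset.sum_congr rfl fun i _ => by ring
  · exact Finset.sum_congr rfl fun i _ => by ring
end
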